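/- arXiv:0803.3419 — 4 statements merged into one kernel-verified Lean document; each statement's English description precedes it below -/
import Mathlib

section
/- Let f ∈ ℚ(t) be a nonconstant rational function in normal form, and suppose f = g ∘ h for nonconstant g, h ∈ ℚ(t). Then there exists a unit u ∈ ℚ(t) such that both g ∘ u and u⁻¹ ∘ h are in normal form (where u⁻¹ is the compositional inverse of u), and f = (g ∘ u) ∘ (u⁻¹ ∘ h). -/
open Polynomial

/-- Composition of rational functions: `rcomp g h = g ∘ h = g(h)`, the image of `g`
under the ℚ-algebra map ℚ(t) → ℚ(t) sending `t` to `h`. -/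
noncomputable def rcomp (g h : RatFunc ℚ) : RatFunc ℚ :=
  Polynomial.aeval h g.num / Polynomial.aeval h g.denom

/-- The degree of a rational function: the maximum of the degrees of its
coprime numerator and denominator. -/
noncomputable def rdeg (f : RatFunc ℚ) : ℕ :=
  max f.num.natDegree f.denom.natDegree

/-- A rational function is nonconstant if it is not in ℚ. -/
def Nonconst (f : RatFunc ℚ) : Prop := ∀ c : ℚ, f ≠ RatFunc.C c

/-- `f = f_N / f_D` (coprime) is in normal form if `deg f_N > deg f_D` and `f_N(0) = 0`. -/
def NormalForm (f : RatFunc ℚ) : Prop :=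
  f.denom.natDegree < f.num.natDegree ∧ f.num.eval 0 = 0

/-- A unit with respect to composition: a rational function of degree 1
(a linear fractional transformation). -/
noncomputable def IsCompUnit (u : RatFunc ℚ) : Prop := rdeg u = 1

section Valuation

variable {K Γ : Type*} [Field K] [LinearOrderedCommGroupWithZero Γ]

lemma valuation_algebraMap_num_div_denom (w : Valuation (RatFunc K) Γ) (f : RatFunc K) :
    w f = w (algebraMap K[X] (RatFunc K) f.num) / w (algebraMap K[X] (RatFunc K) f.denom) := by
  rw [← map_div₀, RatFunc.num_div_denom]

/-- If `w` is trivial on constants and `w x < 1`, then `p(x)` has the residue `p(0)`. -/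
lemma valuation_aeval_sub_lt_one {L : Type*} [Field L] [Algebra K L] (w : Valuation L Γ)
    [w.IsTrivialOn K] {x : L} (hx : w x < 1) (p : K[X]) :
    w (aeval x p - algebraMap K L (p.eval 0)) < 1 := by
  induction p using Polynomial.induction_on' with
  | add p q hp hq =>
    have := w.map_add_lt hp hq
    rwa [sub_add_sub_comm, ← map_add, ← map_add, ← eval_add] at this
  | monomial n a =>
    cases n with
    | zero => simp
    | succ n =>
      have ha : w (algebraMap K L a) ≤ 1 :=
        Valuation.IsTrivialOn.valuation_algebraMap_le_one w a
      have hn : w x ^ n ≤ 1 := pow_le_one' hx.le n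
      simp only [aeval_monomial, eval_monomial, pow_succ, mul_zero, map_zero, sub_zero, map_mul,
        map_pow]
      calc w (algebraMap K L a) * (w x ^ n * w x) ≤ 1 * (1 * w x) := by gcongr
        _ < 1 := by simpa using hx

lemma valuation_algebraMap_eq_one {L : Type*} [Field L] [Algebra K L] (w : Valuation L Γ)
    [hw : w.IsTrivialOn K] {a : K} (ha : a ≠ 0) : w (algebraMap K L a) = 1 :=
  hw.eq_one a ha

lemma valuation_aeval_eq_one {L : Type*} [Field L] [Algebra K L] (w : Valuation L Γ)
    [w.IsTrivialOn K] {x : L} (hx : w x < 1) {p : K[X]} (hp : p.eval 0 ≠ 0) :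
    w (aeval x p) = 1 := by
  have h1 := valuation_algebraMap_eq_one w hp
  have := valuation_aeval_sub_lt_one w hx p
  rw [← h1] at this
  rw [w.map_eq_of_sub_lt this, h1]

lemma valuation_aeval_le_one {L : Type*} [Field L] [Algebra K L] (w : Valuation L Γ)
    [w.IsTrivialOn K] {x : L} (hx : w x < 1) (p : K[X]) : w (aeval x p) ≤ 1 := by
  have := w.map_add_le (valuation_aeval_sub_lt_one w hx p).le
    (Valuation.IsTrivialOn.valuation_algebraMap_le_one w (p.eval 0))
  rwa [sub_add_cancel] at this

instance isTrivialOn_valuation_idealX :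
    ((idealX K).valuation (RatFunc K)).IsTrivialOn K where
  eq_one a ha := by
    rw [IsScalarTower.algebraMap_apply K K[X] (RatFunc K),
      IsDedekindDomain.HeightOneSpectrum.valuation_eq_one_iff_notMem, idealX_span,
      Ideal.mem_span_singleton, X_dvd_iff]
    simpa using ha

lemma valuation_idealX_X_lt_one : (idealX K).valuation (RatFunc K) RatFunc.X < 1 := by
  rw [valuation_X_eq_neg_one, ← WithZero.exp_zero, WithZero.exp_lt_exp]
  norm_num

lemma denom_eval_zero_ne_zero {f : RatFunc K} (h : f.num.eval 0 = 0) : f.denom.eval 0 ≠ 0 := by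
  obtain ⟨a, b, hab⟩ := f.isCoprime_num_denom
  intro h'
  simpa [h, h'] using congrArg (eval 0) hab

lemma algebraMap_eq_aeval_X (p : K[X]) :
    algebraMap K[X] (RatFunc K) p = aeval RatFunc.X p :=
  (RatFunc.aeval_X_left_eq_algebraMap p).symm

lemma valuation_idealX_lt_one_iff (f : RatFunc K) :
    (idealX K).valuation (RatFunc K) f < 1 ↔ f.num.eval 0 = 0 := by
  have hX := valuation_idealX_X_lt_one (K := K)
  rw [valuation_algebraMap_num_div_denom, algebraMap_eq_aeval_X, algebraMap_eq_aeval_X]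
  constructor
  · intro h
    by_contra h0
    rw [valuation_aeval_eq_one _ hX h0] at h
    have hd : aeval (RatFunc.X : RatFunc K) f.denom ≠ 0 := by
      rw [← algebraMap_eq_aeval_X]
      exact RatFunc.algebraMap_ne_zero f.denom_ne_zero
    rw [div_lt_one₀ (by rwa [Valuation.pos_iff])] at h
    exact absurd (valuation_aeval_le_one _ hX _) h.not_ge
  · intro h
    rw [valuation_aeval_eq_one _ hX (denom_eval_zero_ne_zero h), div_one]
    simpa [h] using valuation_aeval_sub_lt_one _ hX f.num

/-- The place at `0` has residue field `K`. -/
lemma exists_valuation_idealX_sub_C_lt_one (f : RatFunc K)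
    (hf : (idealX K).valuation (RatFunc K) f ≤ 1) :
    ∃ a : K, (idealX K).valuation (RatFunc K) (f - RatFunc.C a) < 1 := by
  have hX := valuation_idealX_X_lt_one (K := K)
  set w := (idealX K).valuation (RatFunc K)
  have hd0 : f.denom.eval 0 ≠ 0 := by
    intro hd
    have hn : f.num.eval 0 ≠ 0 := fun hn ↦ denom_eval_zero_ne_zero hn hd
    rw [valuation_algebraMap_num_div_denom, algebraMap_eq_aeval_X, algebraMap_eq_aeval_X,
      valuation_aeval_eq_one _ hX hn] at hf
    have h1 : w (aeval RatFunc.X f.denom) < 1 := by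
      simpa [hd] using valuation_aeval_sub_lt_one w hX f.denom
    have hpos : 0 < w (aeval RatFunc.X f.denom) := by
      rw [Valuation.pos_iff, ← algebraMap_eq_aeval_X]
      exact RatFunc.algebraMap_ne_zero f.denom_ne_zero
    rw [div_le_one₀ hpos] at hf
    exact absurd h1 hf.not_gt
  refine ⟨f.num.eval 0 / f.denom.eval 0, ?_⟩
  have hdw := valuation_aeval_eq_one w hX hd0
  have hd : aeval (RatFunc.X : RatFunc K) f.denom ≠ 0 := by
    rw [← algebraMap_eq_aeval_X]
    exact RatFunc.algebraMap_ne_zero f.denom_ne_zero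
  have key := valuation_aeval_sub_lt_one w hX
    (f.num - Polynomial.C (f.num.eval 0 / f.denom.eval 0) * f.denom)
  have he : f - RatFunc.C (f.num.eval 0 / f.denom.eval 0) =
      aeval RatFunc.X (f.num - Polynomial.C (f.num.eval 0 / f.denom.eval 0) * f.denom) /
        aeval RatFunc.X f.denom := by
    conv_lhs => rw [← RatFunc.num_div_denom f]
    rw [eq_div_iff hd, sub_mul, algebraMap_eq_aeval_X, algebraMap_eq_aeval_X,
      div_mul_cancel₀ _ hd]
    simp
  rw [he, map_div₀, hdw, div_one]
  simpa [hd0] using key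

open scoped Classical in
lemma inftyValuation_eq_exp (f : RatFunc K) (hf : f ≠ 0) :
    RatFunc.inftyValuation K f = WithZero.exp f.intDegree := by
  rw [RatFunc.inftyValuation_apply, RatFunc.inftyValuation_of_nonzero _ hf]

open scoped Classical in
lemma one_lt_inftyValuation_iff (f : RatFunc K) :
    1 < RatFunc.inftyValuation K f ↔ f.denom.natDegree < f.num.natDegree := by
  by_cases hf : f = 0
  · simp [hf]
  · rw [inftyValuation_eq_exp f hf, ← WithZero.exp_zero, WithZero.exp_lt_exp, RatFunc.intDegree]
    omega

open scoped Classical in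
/-- The place at infinity has residue field `K`. -/
lemma exists_inftyValuation_sub_C_lt_one (f : RatFunc K)
    (hf : RatFunc.inftyValuation K f ≤ 1) :
    ∃ a : K, RatFunc.inftyValuation K (f - RatFunc.C a) < 1 := by
  have hdeg : f.num.natDegree ≤ f.denom.natDegree := by
    rw [← not_lt, ← one_lt_inftyValuation_iff]
    exact hf.not_gt
  set a := f.num.coeff f.denom.natDegree
  refine ⟨a, ?_⟩
  have hd := RatFunc.algebraMap_ne_zero f.denom_ne_zero
  set p := f.num - Polynomial.C a * f.denom with hp
  have he : f - RatFunc.C a =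
      algebraMap K[X] (RatFunc K) p / algebraMap K[X] (RatFunc K) f.denom := by
    conv_lhs => rw [← RatFunc.num_div_denom f]
    rw [eq_div_iff hd, sub_mul, div_mul_cancel₀ _ hd]
    simp [hp, RatFunc.algebraMap_C]
  by_cases hp0 : p = 0
  · simp [he, hp0]
  have hlt : p.degree < f.denom.natDegree := by
    rw [Polynomial.degree_lt_iff_coeff_zero]
    intro m hm
    rcases hm.eq_or_lt with rfl | hm
    · simp [hp, a, (RatFunc.monic_denom f).coeff_natDegree]
    · simp [hp, coeff_eq_zero_of_natDegree_lt hm, coeff_eq_zero_of_natDegree_lt (hdeg.trans_lt hm)]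
  have hlt' : p.natDegree < f.denom.natDegree := (natDegree_lt_iff_degree_lt hp0).2 hlt
  rw [he, map_div₀, inftyValuation_eq_exp _ (RatFunc.algebraMap_ne_zero hp0),
    inftyValuation_eq_exp _ hd, RatFunc.intDegree_polynomial, RatFunc.intDegree_polynomial,
    ← WithZero.exp_sub,
    ← WithZero.exp_zero, WithZero.exp_lt_exp]
  omega

end Valuation

section Composition

/-- The `ℚ`-algebra structure on `RatFunc ℚ` that comes from polynomials. It is propositionally, but
not definitionally, equal to the one that every field of characteristic zero carries. -/
noncomputable abbrev ratFuncRatAlgebra : Algebra ℚ (RatFunc ℚ) :=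
  RatFunc.instAlgebraOfPolynomial ℚ ℚ

attribute [local instance] ratFuncRatAlgebra

variable {Γ : Type*} [LinearOrderedCommGroupWithZero Γ]

lemma nonconst_of_valuation (w : Valuation (RatFunc ℚ) Γ) [w.IsTrivialOn ℚ] {x : RatFunc ℚ}
    (hx : 1 < w x) : Nonconst x := by
  rintro c rfl
  rw [← RatFunc.algebraMap_eq_C] at hx
  exact absurd hx (Valuation.IsTrivialOn.valuation_algebraMap_le_one w c).not_gt

lemma Nonconst.transcendental {x : RatFunc ℚ} (hx : Nonconst x) : Transcendental ℚ x :=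
  x.transcendental_of_ne_C fun ⟨c, hc⟩ ↦ hx c hc

lemma Nonconst.sub_C {x : RatFunc ℚ} (hx : Nonconst x) (a : ℚ) :
    Nonconst (x - RatFunc.C a) := fun c hc ↦
  hx (c + a) (by rw [map_add, ← hc, sub_add_cancel])

lemma Nonconst.aeval_ne_zero {x : RatFunc ℚ} (hx : Nonconst x) {p : ℚ[X]} (hp : p ≠ 0) :
    aeval x p ≠ 0 :=
  fun h ↦ hp ((transcendental_iff.1 hx.transcendental) p h)

/-- Composition with a nonconstant rational function on the right, as an algebra map. -/
noncomputable def compHom (x : RatFunc ℚ) (hx : Nonconst x) : RatFunc ℚ →ₐ[ℚ] RatFunc ℚ :=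
  RatFunc.liftAlgHom (aeval x) (nonZeroDivisors_le_comap_nonZeroDivisors_of_injective _
    (transcendental_iff_injective.1 hx.transcendental))

/-- `rcomp` in terms of the `ℚ`-algebra structure inherited from polynomials. -/
lemma rcomp_eq_aeval_div_aeval (g x : RatFunc ℚ) :
    rcomp g x = aeval x g.num / aeval x g.denom := by
  rw [rcomp]
  congr! <;> exact Subsingleton.elim _ _

lemma rcomp_eq_compHom (g : RatFunc ℚ) {x : RatFunc ℚ} (hx : Nonconst x) :
    rcomp g x = compHom x hx g :=
  (rcomp_eq_aeval_div_aeval g x).trans (RatFunc.liftAlgHom_apply _ _ g).symm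

lemma X_rcomp (x : RatFunc ℚ) : rcomp RatFunc.X x = x := by
  simp [rcomp]

lemma rcomp_assoc (f g : RatFunc ℚ) {x : RatFunc ℚ} (hx : Nonconst x) :
    rcomp (rcomp f g) x = rcomp f (rcomp g x) := by
  rw [rcomp_eq_compHom _ hx, rcomp_eq_compHom _ hx, rcomp_eq_aeval_div_aeval,
    rcomp_eq_aeval_div_aeval, map_div₀,
    ← Polynomial.aeval_algHom_apply, ← Polynomial.aeval_algHom_apply]

/-- The values of `g` at a zero of `x` are those of `g` at `0`. -/
lemma valuation_rcomp_of_lt_one (w : Valuation (RatFunc ℚ) Γ) [w.IsTrivialOn ℚ]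
    {g x : RatFunc ℚ} (hc : Nonconst x) (hx : w x < 1) :
    (w (rcomp g x) < 1 → g.num.eval 0 = 0) ∧ (1 < w (rcomp g x) → g.denom.eval 0 = 0) := by
  have hpos : 0 < w (aeval x g.denom) := by
    rw [Valuation.pos_iff]
    exact hc.aeval_ne_zero g.denom_ne_zero
  rw [rcomp_eq_aeval_div_aeval, map_div₀, div_lt_one₀ hpos, one_lt_div₀ hpos]
  constructor <;> intro h <;> by_contra h0 <;> rw [valuation_aeval_eq_one w hx h0] at h <;>
    exact absurd (valuation_aeval_le_one w hx _) h.not_ge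

/-- The values of `g` at a pole of `x` are those of `g` at infinity. -/
lemma valuation_rcomp_of_one_lt (w : Valuation (RatFunc ℚ) Γ) [w.IsTrivialOn ℚ]
    {g x : RatFunc ℚ} (hx : 1 < w x) :
    (w (rcomp g x) < 1 → g.num.natDegree ≤ g.denom.natDegree) ∧
      (1 < w (rcomp g x) → g.denom.natDegree < g.num.natDegree) := by
  by_cases hg : g = 0
  · simp [hg, rcomp]
  have hpos : 0 < w (aeval x g.denom) := by
    rw [Valuation.pos_iff]
    exact (nonconst_of_valuation w hx).aeval_ne_zero g.denom_ne_zero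
  rw [rcomp_eq_aeval_div_aeval, map_div₀, div_lt_one₀ hpos, one_lt_div₀ hpos,
    valuation_aeval_eq_valuation_X_pow_natDegree_of_one_lt_valuation_X x hx g.denom_ne_zero,
    valuation_aeval_eq_valuation_X_pow_natDegree_of_one_lt_valuation_X x hx
      (RatFunc.num_ne_zero hg), pow_lt_pow_iff_right₀ hx, pow_lt_pow_iff_right₀ hx]
  exact ⟨le_of_lt, id⟩

open scoped Classical in
lemma normalForm_iff_valuation (f : RatFunc ℚ) :
    NormalForm f ↔
      (idealX ℚ).valuation (RatFunc ℚ) f < 1 ∧ 1 < RatFunc.inftyValuation ℚ f := by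
  rw [NormalForm, valuation_idealX_lt_one_iff, one_lt_inftyValuation_iff, and_comm]

/-- The linear fractional transformation `(aX + b) / (cX + d)`. -/
noncomputable def moebius (a b c d : ℚ) : RatFunc ℚ :=
  algebraMap ℚ[X] (RatFunc ℚ) (C a * X + C b) / algebraMap ℚ[X] (RatFunc ℚ) (C c * X + C d)

variable {a b c d : ℚ}

lemma moebius_denom_ne_zero (h : a * d - b * c ≠ 0) : (C c * X + C d : ℚ[X]) ≠ 0 := by
  intro h0
  have h1 : c = 0 := by simpa using congrArg (coeff · 1) h0
  have h2 : d = 0 := by simpa using congrArg (coeff · 0) h0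
  simp [h1, h2] at h

lemma isCompUnit_moebius (h : a * d - b * c ≠ 0) : IsCompUnit (moebius a b c d) := by
  have hq := moebius_denom_ne_zero h
  have hcop : IsCoprime (C a * X + C b : ℚ[X]) (C c * X + C d) := by
    by_cases hc : c = 0
    · have hd : d ≠ 0 := by rintro rfl; simp [hc] at h
      subst hc
      refine ⟨0, C d⁻¹, ?_⟩
      simp [← C_mul, hd]
    · refine ⟨C (-c / (a * d - b * c)), C (a / (a * d - b * c)), ?_⟩
      have : (C (-c / (a * d - b * c)) * (C a * X + C b) + C (a / (a * d - b * c)) *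
          (C c * X + C d) : ℚ[X]) = C ((-c / (a * d - b * c)) * a + a / (a * d - b * c) * c) * X +
          C ((-c / (a * d - b * c)) * b + a / (a * d - b * c) * d) := by
        simp only [C_add, C_mul]; ring
      rw [this, show (-c / (a * d - b * c)) * a + a / (a * d - b * c) * c = 0 by ring,
        show (-c / (a * d - b * c)) * b + a / (a * d - b * c) * d = 1 by
          rw [div_mul_eq_mul_div, div_mul_eq_mul_div, ← add_div, div_eq_one_iff_eq h]; ring]
      simp
  have heq := (RatFunc.num_mul_eq_mul_denom_iff (x := moebius a b c d) hq).2 rfl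
  have hcop' := (moebius a b c d).isCoprime_num_denom
  have hn : Associated (moebius a b c d).num (C a * X + C b) :=
    associated_of_dvd_dvd (hcop'.dvd_of_dvd_mul_right ⟨_, heq.symm⟩)
      (hcop.dvd_of_dvd_mul_right ⟨_, heq⟩)
  have hd : Associated (moebius a b c d).denom (C c * X + C d) :=
    associated_of_dvd_dvd (hcop'.symm.dvd_of_dvd_mul_left ⟨_, by rw [heq, mul_comm]⟩)
      (hcop.symm.dvd_of_dvd_mul_left ⟨_, by rw [← heq, mul_comm]⟩)
  rw [IsCompUnit, rdeg, natDegree_eq_of_degree_eq (degree_eq_degree_of_associated hn),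
    natDegree_eq_of_degree_eq (degree_eq_degree_of_associated hd)]
  by_cases ha : a = 0
  · have hc : c ≠ 0 := by rintro rfl; simp [ha] at h
    rw [natDegree_linear hc]
    simp [ha]
  · rw [natDegree_linear ha]
    exact max_eq_left natDegree_linear_le

lemma IsCompUnit.nonconst {u : RatFunc ℚ} (hu : IsCompUnit u) : Nonconst u := by
  rintro c rfl
  simp [IsCompUnit, rdeg, -eq_ratCast] at hu

lemma moebius_rcomp {x : RatFunc ℚ} (hx : Nonconst x) :
    rcomp (moebius a b c d) x =
      (RatFunc.C a * x + RatFunc.C b) / (RatFunc.C c * x + RatFunc.C d) := by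
  rw [rcomp_eq_compHom _ hx, compHom, moebius, RatFunc.liftAlgHom_apply_div]
  simp [RatFunc.algebraMap_eq_C, -eq_ratCast]

lemma moebius_rcomp_inverse (h : a * d - b * c ≠ 0) :
    rcomp (moebius a b c d) (moebius d (-b) (-c) a) = RatFunc.X := by
  have h' : d * a - -b * -c ≠ 0 := by convert h using 1; ring
  have hu := (isCompUnit_moebius h').nonconst
  have hq := RatFunc.algebraMap_ne_zero (moebius_denom_ne_zero h')
  have hC : RatFunc.C a * RatFunc.C d - RatFunc.C b * RatFunc.C c ≠ (0 : RatFunc ℚ) := by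
    rw [← map_mul, ← map_mul, ← map_sub]
    exact (_root_.map_ne_zero _).2 h
  rw [moebius_rcomp hu, moebius]
  simp only [map_add, map_mul, RatFunc.algebraMap_C, RatFunc.algebraMap_X, map_neg] at hq ⊢
  have hn : RatFunc.C c * ((RatFunc.C d * RatFunc.X + -RatFunc.C b) /
      (-RatFunc.C c * RatFunc.X + RatFunc.C a)) + RatFunc.C d =
      (RatFunc.C a * RatFunc.C d - RatFunc.C b * RatFunc.C c) /
        (-RatFunc.C c * RatFunc.X + RatFunc.C a) := by
    rw [eq_div_iff hq, add_mul, mul_assoc, div_mul_cancel₀ _ hq]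
    ring
  rw [hn, div_eq_iff (div_ne_zero hC hq), ← mul_div_assoc, ← mul_div_assoc, eq_div_iff hq,
    add_mul,    div_mul_cancel₀ _ hq]
  ring

open scoped Classical in
/-- If `g ∘ h` is in normal form, then the values of `h` at `0` and `∞` are distinct, so some
linear fractional transformation moves them to `0` and `∞`. -/
lemma exists_moebius_rcomp_normalForm {g h : RatFunc ℚ} (hh : Nonconst h)
    (hnf : NormalForm (rcomp g h)) :
    ∃ a b c d : ℚ, a * d - b * c ≠ 0 ∧ NormalForm (rcomp (moebius a b c d) h) := by
  simp only [normalForm_iff_valuation, moebius_rcomp hh] at hnf ⊢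
  obtain ⟨hf0, hf1⟩ := hnf
  set v := (idealX ℚ).valuation (RatFunc ℚ)
  set w := RatFunc.inftyValuation ℚ
  have hsub (c : ℚ) : h - RatFunc.C c ≠ 0 := by
    intro hc
    exact hh c (sub_eq_zero.1 hc)
  rcases le_or_gt (v h) 1 with hv | hv <;> rcases le_or_gt (w h) 1 with hw | hw
  · obtain ⟨a, ha⟩ := exists_valuation_idealX_sub_C_lt_one h hv
    obtain ⟨b, hb⟩ := exists_inftyValuation_sub_C_lt_one h hw
    have hab : a ≠ b := by
      rintro rfl
      have hc := hh.sub_C a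
      have hX : Nonconst (moebius 1 a 0 1) :=
        (isCompUnit_moebius (by norm_num)).nonconst
      have hr : rcomp (rcomp g (moebius 1 a 0 1)) (h - RatFunc.C a) = rcomp g h := by
        rw [rcomp_assoc _ _ hc, moebius_rcomp hc]
        simp
      rw [← hr] at hf0 hf1
      exact denom_eval_zero_ne_zero ((valuation_rcomp_of_lt_one v hc ha).1 hf0)
        ((valuation_rcomp_of_lt_one w hc hb).2 hf1)
    have hv' : v (h - RatFunc.C b) = 1 := by
      have h1 : v (RatFunc.C (a - b)) = 1 :=
        valuation_algebraMap_eq_one v (sub_ne_zero.2 hab)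
      rw [← h1, ← v.map_add_eq_of_lt_right (lt_of_lt_of_eq ha h1.symm), map_sub RatFunc.C]
      congr 1
      ring
    have hw' : w (h - RatFunc.C a) = 1 := by
      have h1 : w (RatFunc.C (b - a)) = 1 :=
        valuation_algebraMap_eq_one w (sub_ne_zero.2 hab.symm)
      rw [← h1, ← w.map_add_eq_of_lt_right (lt_of_lt_of_eq hb h1.symm), map_sub RatFunc.C]
      congr 1
      ring
    refine ⟨1, -a, 1, -b, ?_, ?_⟩
    · intro h0
      exact hab (by linarith)
    · simp only [map_one, one_mul, map_neg, ← sub_eq_add_neg, map_div₀, hv', hw', div_one]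
      exact ⟨ha, (one_lt_div₀ ((w.pos_iff).2 (hsub b))).2 hb⟩
  · obtain ⟨a, ha⟩ := exists_valuation_idealX_sub_C_lt_one h hv
    refine ⟨1, -a, 0, 1, by norm_num, ?_⟩
    simp only [map_one, one_mul, map_neg, ← sub_eq_add_neg, map_zero, zero_mul, zero_add, div_one]
    refine ⟨ha, ?_⟩
    rwa [w.map_sub_eq_of_lt_left]
    exact (Valuation.IsTrivialOn.valuation_algebraMap_le_one w a).trans_lt hw
  · obtain ⟨b, hb⟩ := exists_inftyValuation_sub_C_lt_one h hw
    refine ⟨0, 1, 1, -b, by norm_num, ?_⟩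
    simp only [map_one, one_mul, map_neg, ← sub_eq_add_neg, map_zero, zero_mul, zero_add, map_div₀]
    refine ⟨?_, (one_lt_div₀ ((w.pos_iff).2 (hsub b))).2 hb⟩
    rw [div_lt_one₀ ((v.pos_iff).2 (hsub b)), v.map_sub_eq_of_lt_left]
    · exact hv
    · exact (Valuation.IsTrivialOn.valuation_algebraMap_le_one v b).trans_lt hv
  · exact absurd ((valuation_rcomp_of_one_lt w hw).2 hf1)
      ((valuation_rcomp_of_one_lt v hv).1 hf0).not_gt

open scoped Classical in
/-- A left factor of a normal form is in normal form if the right factor is. -/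
lemma NormalForm.of_rcomp {g h : RatFunc ℚ} (hf : NormalForm (rcomp g h)) (hh : NormalForm h) :
    NormalForm g := by
  rw [normalForm_iff_valuation] at hf hh
  exact ⟨(valuation_rcomp_of_one_lt _ hh.2).2 hf.2,
    (valuation_rcomp_of_lt_one _ (nonconst_of_valuation _ hh.2) hh.1).1 hf.1⟩

lemma NormalForm.nonconst {f : RatFunc ℚ} (hf : NormalForm f) : Nonconst f := by
  rintro c rfl
  simp [NormalForm, -eq_ratCast] at hf

end Composition

/-- If `f` is in normal form and `f = g ∘ h`, then there is a unit `u` (with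
compositional inverse `v = u⁻¹`) such that `g ∘ u` and `u⁻¹ ∘ h` are in normal form,
and `f = (g ∘ u) ∘ (u⁻¹ ∘ h)`. -/
theorem normalForm_decomposition (f g h : RatFunc ℚ) (hf : Nonconst f) (hg : Nonconst g)
    (hh : Nonconst h) (hnf : NormalForm f) (hfe : f = rcomp g h) :
    ∃ u v : RatFunc ℚ, IsCompUnit u ∧
      rcomp u v = RatFunc.X ∧ rcomp v u = RatFunc.X ∧
      NormalForm (rcomp g u) ∧ NormalForm (rcomp v h) ∧
      f = rcomp (rcomp g u) (rcomp v h) := by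
  subst hfe
  obtain ⟨a, b, c, d, hdet, hv⟩ := exists_moebius_rcomp_normalForm hh hnf
  have hdet' : d * a - -b * -c ≠ 0 := by
    convert hdet using 1
    ring
  have huv : rcomp (moebius d (-b) (-c) a) (moebius a b c d) = RatFunc.X := by
    simpa using moebius_rcomp_inverse hdet'
  have hcomp : rcomp (rcomp g (moebius d (-b) (-c) a)) (rcomp (moebius a b c d) h) =
      rcomp g h := by
    rw [rcomp_assoc _ _ hv.nonconst, ← rcomp_assoc _ _ hh, huv, X_rcomp]
  exact ⟨moebius d (-b) (-c) a, moebius a b c d, isCompUnit_moebius hdet', huv,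
    moebius_rcomp_inverse hdet, NormalForm.of_rcomp (hcomp.symm ▸ hnf) hv, hv, hcomp.symm⟩
end

section
/- Let f, g, h ∈ ℚ(t) be nonconstant rational functions with f = g ∘ h, where f = f_N/f_D and h = h_N/h_D with f_N, f_D ∈ ℚ[t] coprime and h_N, h_D ∈ ℚ[t] coprime. If f, g, and h are all in normal form, then h_N divides f_N and h_D divides f_D in ℚ[t]. -/
open Polynomial

/-- The degree-`n` homogenization of `p` evaluated at the pair `(a, b)`. -/
noncomputable def homogenizeEval (a b : ℚ[X]) (n : ℕ) (p : ℚ[X]) : ℚ[X] :=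
  ∑ i ∈ Finset.range (n + 1), C (p.coeff i) * a ^ i * b ^ (n - i)

theorem algebraMap_homogenizeEval {a b : ℚ[X]} (hb : b ≠ 0) {n : ℕ} {p : ℚ[X]}
    (hp : p.natDegree ≤ n) :
    algebraMap ℚ[X] (RatFunc ℚ) (homogenizeEval a b n p) =
      aeval (algebraMap ℚ[X] (RatFunc ℚ) a / algebraMap ℚ[X] (RatFunc ℚ) b) p *
        algebraMap ℚ[X] (RatFunc ℚ) b ^ n := by
  have hb' : algebraMap ℚ[X] (RatFunc ℚ) b ≠ 0 := RatFunc.algebraMap_ne_zero hb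
  rw [aeval_eq_sum_range' (Nat.lt_succ_of_le hp), Finset.sum_mul, homogenizeEval, map_sum]
  refine Finset.sum_congr rfl fun i hi => ?_
  have hi' : i ≤ n := Nat.lt_succ_iff.mp (Finset.mem_range.mp hi)
  rw [map_mul, map_mul, map_pow, map_pow, pow_sub₀ _ hb' hi', Algebra.smul_def,
    RatFunc.algebraMap_C, eq_ratCast RatFunc.C, eq_ratCast (algebraMap ℚ (RatFunc ℚ)),
    div_pow]
  field_simp

theorem isCoprime_homogenizeEval_natDegree {a b p : ℚ[X]} (hab : IsCoprime a b) (hp : p ≠ 0) :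
    IsCoprime (homogenizeEval a b p.natDegree p) b := by
  obtain ⟨r, hr⟩ : b ∣ ∑ i ∈ Finset.range p.natDegree,
      C (p.coeff i) * a ^ i * b ^ (p.natDegree - i) :=
    Finset.dvd_sum fun i hi =>
      Dvd.dvd.mul_left (dvd_pow_self b (Nat.sub_ne_zero_of_lt (Finset.mem_range.mp hi))) _
  have hunit : IsUnit (C (p.coeff p.natDegree)) :=
    isUnit_C.mpr (isUnit_iff_ne_zero.mpr (leadingCoeff_ne_zero.mpr hp))
  rw [homogenizeEval, Finset.sum_range_succ, hr, Nat.sub_self, pow_zero, mul_one, add_comm]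
  exact ((isCoprime_mul_unit_left_left hunit _ _).mpr hab.pow_left).add_mul_left_left r

theorem isCoprime_homogenizeEval {a b p q : ℚ[X]} (hab : IsCoprime a b) (hb : b ≠ 0)
    (hpq : IsCoprime p q) (hp : p ≠ 0) (hdeg : q.natDegree ≤ p.natDegree) :
    IsCoprime (homogenizeEval a b p.natDegree p) (homogenizeEval a b p.natDegree q) := by
  obtain ⟨u, v, huv⟩ := hpq
  set m := max u.natDegree v.natDegree
  have key : homogenizeEval a b m u * homogenizeEval a b p.natDegree p +
      homogenizeEval a b m v * homogenizeEval a b p.natDegree q = b ^ (m + p.natDegree) := by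
    apply RatFunc.algebraMap_injective ℚ
    have h := congrArg
      (aeval (algebraMap ℚ[X] (RatFunc ℚ) a / algebraMap ℚ[X] (RatFunc ℚ) b)) huv
    simp only [map_add, map_mul, map_one] at h
    rw [map_add, map_mul, map_mul, map_pow, algebraMap_homogenizeEval hb (le_max_left _ _),
      algebraMap_homogenizeEval hb (le_max_right _ _), algebraMap_homogenizeEval hb le_rfl,
      algebraMap_homogenizeEval hb hdeg]
    linear_combination algebraMap ℚ[X] (RatFunc ℚ) b ^ (m + p.natDegree) * h
  have hcop := (isCoprime_homogenizeEval_natDegree hab hp).pow_right (n := m + p.natDegree)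
  rw [← key, add_comm] at hcop
  exact (IsCoprime.add_mul_right_right_iff.mp hcop).of_mul_right_right

/-- If `f = g ∘ h` with `f = f_N/f_D` and `h = h_N/h_D` in coprime representation, and
`f, g, h` are all in normal form, then `h_N ∣ f_N` and `h_D ∣ f_D` in ℚ[X]. -/
theorem num_denom_dvd (f g h : RatFunc ℚ) (fN fD hN hD : ℚ[X])
    (hf : Nonconst f) (hg : Nonconst g) (hh : Nonconst h)
    (hfrep : f = algebraMap ℚ[X] (RatFunc ℚ) fN / algebraMap ℚ[X] (RatFunc ℚ) fD)
    (hfcop : IsCoprime fN fD)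
    (hhrep : h = algebraMap ℚ[X] (RatFunc ℚ) hN / algebraMap ℚ[X] (RatFunc ℚ) hD)
    (hhcop : IsCoprime hN hD)
    (hcomp : f = rcomp g h)
    (hnf : NormalForm f) (hng : NormalForm g) (hnh : NormalForm h) :
    hN ∣ fN ∧ hD ∣ fD := by
  have hf0 : f ≠ 0 := by simpa using hf 0
  have hh0 : h ≠ 0 := by simpa using hh 0
  have hg0 : g ≠ 0 := by simpa using hg 0
  have hfD : fD ≠ 0 := by rintro rfl; exact hf0 (by simp [hfrep])
  have hhD : hD ≠ 0 := by rintro rfl; exact hh0 (by simp [hhrep])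
  have hp0 : g.num ≠ 0 := RatFunc.num_ne_zero hg0
  obtain ⟨hdeg, hzero⟩ := hng
  obtain ⟨p, hp⟩ : X ∣ g.num := X_dvd_iff.mpr (by rwa [coeff_zero_eq_eval_zero])
  have hpne : p ≠ 0 := by rintro rfl; exact hp0 (by simp [hp])
  obtain ⟨n, hn⟩ : ∃ n, g.num.natDegree = n + 1 := ⟨_, by rw [hp, natDegree_X_mul hpne]⟩
  have hpn : p.natDegree ≤ n := by
    have := natDegree_X_mul hpne
    rw [← hp] at this
    omega
  have hqn : g.denom.natDegree ≤ n := by omega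
  have hcop := isCoprime_homogenizeEval hhcop hhD g.isCoprime_num_denom hp0 hdeg.le
  set P := homogenizeEval hN hD g.num.natDegree g.num
  set Q := homogenizeEval hN hD g.num.natDegree g.denom
  have hP : algebraMap ℚ[X] (RatFunc ℚ) P =
      aeval h g.num * algebraMap ℚ[X] (RatFunc ℚ) hD ^ g.num.natDegree := by
    rw [hhrep]; exact algebraMap_homogenizeEval hhD le_rfl
  have hQ : algebraMap ℚ[X] (RatFunc ℚ) Q =
      aeval h g.denom * algebraMap ℚ[X] (RatFunc ℚ) hD ^ g.num.natDegree := by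
    rw [hhrep]; exact algebraMap_homogenizeEval hhD hdeg.le
  have hhD' : algebraMap ℚ[X] (RatFunc ℚ) hD ≠ 0 := RatFunc.algebraMap_ne_zero hhD
  have hfD' : algebraMap ℚ[X] (RatFunc ℚ) fD ≠ 0 := RatFunc.algebraMap_ne_zero hfD
  have hNP : hN ∣ P := by
    refine ⟨homogenizeEval hN hD n p, RatFunc.algebraMap_injective ℚ ?_⟩
    rw [hP, map_mul, algebraMap_homogenizeEval hhD hpn, ← hhrep, hn, hp, map_mul, aeval_X]
    nth_rw 1 [hhrep]
    field_simp
    ring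
  have hDQ : hD ∣ Q := by
    refine ⟨homogenizeEval hN hD n g.denom, RatFunc.algebraMap_injective ℚ ?_⟩
    rw [hQ, map_mul, algebraMap_homogenizeEval hhD hqn, ← hhrep, hn]
    ring
  have hq : aeval h g.denom ≠ 0 := by
    intro hq
    exact hf0 (by rw [hcomp, rcomp, hq, div_zero])
  have hcross : fN * Q = fD * P := by
    apply RatFunc.algebraMap_injective ℚ
    rw [map_mul, map_mul, hP, hQ]
    have := hfrep.symm.trans hcomp
    rw [rcomp, div_eq_div_iff hfD' hq] at this
    linear_combination algebraMap ℚ[X] (RatFunc ℚ) hD ^ g.num.natDegree * this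
  exact ⟨hNP.trans (hcop.dvd_of_dvd_mul_right (hcross ▸ dvd_mul_left P fD)),
    hDQ.trans (hcop.symm.dvd_of_dvd_mul_right (hcross ▸ dvd_mul_left Q fN))⟩
end

section
/- In ℚ(t), the rational function f = t³(t³ + 6³)³/(t³ − 3³)³ satisfies the composition identity f = t³ ∘ (t(t − 12)/(t − 3)) ∘ (t(t + 6)/(t − 3)). -/
open Polynomial

theorem rcomp_algebraMap_div (p q : ℚ[X]) (h : RatFunc ℚ) (hq : aeval h q ≠ 0) :
    rcomp (algebraMap ℚ[X] (RatFunc ℚ) p / algebraMap ℚ[X] (RatFunc ℚ) q) h =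
      aeval h p / aeval h q := by
  have hq0 : q ≠ 0 := by
    rintro rfl
    simp at hq
  have hd : aeval h (RatFunc.denom (algebraMap ℚ[X] (RatFunc ℚ) p / algebraMap ℚ[X] _ q)) ≠ 0 :=
    fun h0 => hq (aeval_eq_zero_of_dvd_aeval_eq_zero (RatFunc.denom_div_dvd p q) h0)
  have key := (RatFunc.num_mul_eq_mul_denom_iff (x := algebraMap ℚ[X] (RatFunc ℚ) p /
    algebraMap ℚ[X] _ q) (p := p) hq0).2 rfl
  rw [rcomp, div_eq_div_iff hd hq, ← map_mul, ← map_mul, key]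

theorem rcomp_X_pow (n : ℕ) (h : RatFunc ℚ) : rcomp (RatFunc.X ^ n) h = h ^ n := by
  simpa using rcomp_algebraMap_div (X ^ n) 1 h (by simp)

theorem algebraMap_ne_zero_of_eval_ne_zero {p : ℚ[X]} {a : ℚ} (hp : p.eval a ≠ 0) :
    algebraMap ℚ[X] (RatFunc ℚ) p ≠ 0 := by
  apply RatFunc.algebraMap_ne_zero
  rintro rfl
  simp at hp

/-- The rational function `f = t³(t³ + 6³)³/(t³ − 3³)³` decomposes as
`f = t³ ∘ (t(t − 12)/(t − 3)) ∘ (t(t + 6)/(t − 3))`. -/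
theorem decomposition_length_three :
    (RatFunc.X ^ 3 * (RatFunc.X ^ 3 + RatFunc.C (6 ^ 3 : ℚ)) ^ 3) /
        (RatFunc.X ^ 3 - RatFunc.C (3 ^ 3 : ℚ)) ^ 3 =
      rcomp (rcomp (RatFunc.X ^ 3)
          (RatFunc.X * (RatFunc.X - RatFunc.C (12 : ℚ)) / (RatFunc.X - RatFunc.C (3 : ℚ))))
        (RatFunc.X * (RatFunc.X + RatFunc.C (6 : ℚ)) / (RatFunc.X - RatFunc.C (3 : ℚ))) := by
  have h1 : (RatFunc.X - 3 : RatFunc ℚ) ≠ 0 := by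
    have h := algebraMap_ne_zero_of_eval_ne_zero (p := X - 3) (a := 0) (by simp)
    simp only [map_sub, RatFunc.algebraMap_X, map_ofNat] at h
    exact h
  have h2 : (RatFunc.X ^ 2 + 3 * RatFunc.X + 9 : RatFunc ℚ) ≠ 0 := by
    have h := algebraMap_ne_zero_of_eval_ne_zero (p := X ^ 2 + 3 * X + 9) (a := 0) (by simp)
    simp only [map_add, map_mul, map_pow, RatFunc.algebraMap_X, map_ofNat] at h
    exact h
  have h_sub_three : RatFunc.X * (RatFunc.X + 6) / (RatFunc.X - 3) - 3 =
      ((RatFunc.X ^ 2 + 3 * RatFunc.X + 9) / (RatFunc.X - 3) : RatFunc ℚ) := by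
    field_simp
    ring
  have h_sub_twelve : RatFunc.X * (RatFunc.X + 6) / (RatFunc.X - 3) - 12 =
      ((RatFunc.X ^ 2 - 6 * RatFunc.X + 36) / (RatFunc.X - 3) : RatFunc ℚ) := by
    field_simp
    ring
  have hg : ((RatFunc.X * (RatFunc.X - 12) / (RatFunc.X - 3)) ^ 3 : RatFunc ℚ) =
      algebraMap ℚ[X] (RatFunc ℚ) ((X * (X - 12)) ^ 3) /
        algebraMap ℚ[X] (RatFunc ℚ) ((X - 3) ^ 3) := by
    simp only [div_pow, map_sub, map_mul, map_pow, RatFunc.algebraMap_X, map_ofNat]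
  rw [rcomp_X_pow]
  norm_num only [map_ofNat]
  rw [hg, rcomp_algebraMap_div]
  · simp only [map_pow, map_mul, map_sub, aeval_X, map_ofNat]
    rw [h_sub_three, h_sub_twelve, show (RatFunc.X ^ 3 - 27 : RatFunc ℚ) =
      (RatFunc.X - 3) * (RatFunc.X ^ 2 + 3 * RatFunc.X + 9) by ring]
    field_simp
    ring
  · simp only [map_pow, map_sub, aeval_X, map_ofNat]
    rw [h_sub_three]
    exact pow_ne_zero _ (div_ne_zero h2 h1)
end

section
/- The rational function g = t³(t + 24)/(t − 3) ∈ ℚ(t), of degree 4, is indecomposable: g is not a unit under composition, and in every decomposition g = p ∘ q with p, q ∈ ℚ(t) nonconstant, either p or q is a unit (has degree 1). -/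
open Polynomial

/-- A rational function is indecomposable if it is nonconstant, not a unit under
composition, and in every decomposition into two nonconstant rational functions one
of the components is a unit. -/
noncomputable def Indecomposable (f : RatFunc ℚ) : Prop :=
  Nonconst f ∧ ¬ IsCompUnit f ∧
  ∀ g h : RatFunc ℚ, Nonconst g → Nonconst h → f = rcomp g h →
    IsCompUnit g ∨ IsCompUnit h

open IntermediateField in
/-- The degree is multiplicative: `deg (g ∘ h) = deg g * deg h`. -/
lemma RatFunc.max_natDegree_eval₂_div_eval₂ {K : Type*} [Field K] (g h : RatFunc K)
    (hh : ¬ ∃ c, h = C c) :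
    max (eval₂ C h g.num / eval₂ C h g.denom).num.natDegree
      (eval₂ C h g.num / eval₂ C h g.denom).denom.natDegree =
    max g.num.natDegree g.denom.natDegree * max h.num.natDegree h.denom.natDegree := by
  have ht := transcendental_of_ne_C h hh
  let φ : RatFunc K →ₐ[K] RatFunc K :=
    K⟮h⟯.val.comp (algEquivOfTranscendental h ht).toAlgHom
  have hφ (u : RatFunc K) : φ u = eval₂ C h u.num / eval₂ C h u.denom :=
    algEquivOfTranscendental_apply h ht u
  have htop : (⊤ : IntermediateField K (RatFunc K)).map φ = K⟮h⟯ := by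
    rw [← AlgHom.fieldRange_eq_map]
    ext x
    refine ⟨?_, fun hx => ?_⟩
    · rintro ⟨y, rfl⟩
      exact (algEquivOfTranscendental h ht y).2
    · obtain ⟨y, hy⟩ := (algEquivOfTranscendental h ht).surjective ⟨x, hx⟩
      exact ⟨y, congrArg Subtype.val hy⟩
  have hgen : K⟮g⟯.map φ = K⟮φ g⟯ := by simp [adjoin_map]
  have hle : K⟮φ g⟯ ≤ K⟮h⟯ := hgen ▸ htop ▸ IntermediateField.map_mono φ le_top
  have hmul := relfinrank_mul_finrank_top hle
  rw [← hgen, ← htop, relfinrank_map_map, relfinrank_top_right, hgen, htop] at hmul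
  rw [← hφ, ← finrank_eq_max_natDegree, ← finrank_eq_max_natDegree, ← finrank_eq_max_natDegree,
    hmul]

lemma eval_zero_of_X_pow_three_mul_eq_mul {K : Type*} [Field K] {L M U : K[X]}
    (hdeg : L.natDegree ≤ 2) (hU : U.eval 0 ≠ 0) (h : X ^ 3 * U = L * M) : M.eval 0 = 0 := by
  by_contra hM
  have hcop : IsCoprime (X ^ 3) M := by
    refine IsCoprime.pow_left ((irreducible_X.coprime_iff_not_dvd).2 ?_)
    rwa [X_dvd_iff, coeff_zero_eq_eval_zero]
  have hdvd : X ^ 3 ∣ L := hcop.dvd_of_dvd_mul_right ⟨U, h.symm⟩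
  have hL : L = 0 := eq_zero_of_dvd_of_natDegree_lt hdvd (by simp; lia)
  rw [hL, zero_mul, mul_eq_zero] at h
  rcases h with h | h
  · exact pow_ne_zero 3 X_ne_zero h
  · simp [h] at hU

lemma X_pow_three_mul_ne_C_mul_sq {K : Type*} [Field K] {U : K[X]} (hU : U.eval 0 ≠ 0)
    (c : K) (L : K[X]) : X ^ 3 * U ≠ C c * L ^ 2 := by
  intro h
  have hc : c ≠ 0 := by
    rintro rfl
    rw [C_0, zero_mul, mul_eq_zero] at h
    rcases h with h | h
    · exact pow_ne_zero 3 X_ne_zero h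
    · simp [h] at hU
  have h0 : L.eval 0 = 0 := by simpa [hc] using congrArg (eval 0) h
  obtain ⟨N, rfl⟩ : X ∣ L := by rwa [X_dvd_iff, coeff_zero_eq_eval_zero]
  have h1 : X * U = C c * N ^ 2 :=
    mul_left_cancel₀ (pow_ne_zero 2 X_ne_zero) (by linear_combination h)
  have h2 : N.eval 0 = 0 := by simpa [hc] using congrArg (eval 0) h1
  obtain ⟨N', rfl⟩ : X ∣ N := by rwa [X_dvd_iff, coeff_zero_eq_eval_zero]
  have h3 : U = C c * X * N' ^ 2 := mul_left_cancel₀ X_ne_zero (by linear_combination h1)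
  simp [h3] at hU

/-- A binary quadratic form evaluated at two polynomials of degree at most two without a common
zero at the origin cannot vanish to order exactly three at the origin. -/
lemma X_pow_three_mul_ne_quadratic {K : Type*} [Field K] {A B U : K[X]}
    (hA : A.natDegree ≤ 2) (hB : B.natDegree ≤ 2) (hAB : IsCoprime A B) (hU : U.eval 0 ≠ 0)
    (p q r : K) : X ^ 3 * U ≠ C p * A ^ 2 + C q * A * B + C r * B ^ 2 := by
  intro h
  set a := A.eval 0 with ha
  set b := B.eval 0 with hb
  have h0 : p * a ^ 2 + q * a * b + r * b ^ 2 = 0 := by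
    simpa [← ha, ← hb] using (congrArg (eval 0) h).symm
  by_cases hb0 : b = 0
  · have ha0 : a ≠ 0 := by
      intro ha0
      obtain ⟨u, v, huv⟩ := hAB
      simpa [← ha, ← hb, ha0, hb0] using congrArg (eval 0) huv
    have hp : p = 0 := by simpa [hb0, ha0] using h0
    subst hp
    have h1 : X ^ 3 * U = B * (C q * A + C r * B) := by rw [h, C_0]; ring
    have hq := eval_zero_of_X_pow_three_mul_eq_mul hB hU h1
    have hq : q = 0 := by simpa [← ha, ← hb, hb0, ha0] using hq
    subst hq
    exact X_pow_three_mul_ne_C_mul_sq hU r B (by rw [h1, C_0]; ring)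
  · set L := C b * A - C a * B with hL
    have hdeg : L.natDegree ≤ 2 :=
      natDegree_sub_le_of_le ((natDegree_C_mul_le _ _).trans hA) ((natDegree_C_mul_le _ _).trans hB)
    have hU' : (C (b ^ 2) * U).eval 0 ≠ 0 := by simpa [hb0] using hU
    have h0' : C p * C a ^ 2 + C q * C a * C b + C r * C b ^ 2 = 0 := by
      simpa using congrArg C h0
    have h1 : X ^ 3 * (C (b ^ 2) * U) = L * (C (p * b) * A + C (q * b + p * a) * B) := by
      simp only [hL, C_mul, C_add, C_pow]
      linear_combination C b ^ 2 * h + B ^ 2 * h0'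
    have h2 := eval_zero_of_X_pow_three_mul_eq_mul hdeg hU' h1
    have h3 : q * b + p * a = - (p * a) := by
      have h4 : b * (q * b + p * a + p * a) = 0 := by
        simp [← ha, ← hb] at h2
        linear_combination h2
      linear_combination (mul_eq_zero.1 h4).resolve_left hb0
    refine X_pow_three_mul_ne_C_mul_sq hU' p L ?_
    rw [h1, h3, hL]
    simp only [C_mul, C_neg]
    ring

lemma rcomp_eq_eval₂ (g h : RatFunc ℚ) :
    rcomp g h = eval₂ RatFunc.C h g.num / eval₂ RatFunc.C h g.denom := by
  rw [rcomp, aeval_def, aeval_def, Subsingleton.elim (algebraMap ℚ (RatFunc ℚ)) RatFunc.C]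

lemma rdeg_rcomp (g h : RatFunc ℚ) (hh : Nonconst h) : rdeg (rcomp g h) = rdeg g * rdeg h := by
  rw [rcomp_eq_eval₂]
  exact RatFunc.max_natDegree_eval₂_div_eval₂ g h fun ⟨c, hc⟩ => hh c hc

lemma num_mul_eq_mul_denom_degree_four :
    (RatFunc.X ^ 3 * (RatFunc.X + RatFunc.C (24 : ℚ)) / (RatFunc.X - RatFunc.C (3 : ℚ))).num *
      (X - C 3) = X ^ 3 * (X + C 24) *
    (RatFunc.X ^ 3 * (RatFunc.X + RatFunc.C (24 : ℚ)) / (RatFunc.X - RatFunc.C (3 : ℚ))).denom := by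
  rw [RatFunc.num_mul_eq_mul_denom_iff (X_sub_C_ne_zero 3)]
  simp

lemma rdeg_degree_four :
    rdeg (RatFunc.X ^ 3 * (RatFunc.X + RatFunc.C (24 : ℚ)) / (RatFunc.X - RatFunc.C (3 : ℚ))) =
      4 := by
  have h := num_mul_eq_mul_denom_degree_four
  unfold rdeg
  set f := RatFunc.X ^ 3 * (RatFunc.X + RatFunc.C (24 : ℚ)) / (RatFunc.X - RatFunc.C (3 : ℚ))
  have hd0 := f.denom_ne_zero
  have hdvd : f.denom ∣ X - C 3 := (RatFunc.isCoprime_num_denom f).symm.dvd_of_dvd_mul_left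
    ⟨X ^ 3 * (X + C 24), by rw [h, mul_comm]⟩
  have hd1 := natDegree_le_of_dvd hdvd (X_sub_C_ne_zero 3)
  have hroot : f.denom.eval 3 = 0 := by
    have := congrArg (eval 3) h
    norm_num at this
    exact this
  have hpos : f.denom.natDegree ≠ 0 := by
    intro h0
    rw [eq_C_of_natDegree_eq_zero h0, eval_C] at hroot
    exact hd0 (by rw [eq_C_of_natDegree_eq_zero h0, hroot, C_0])
  have h4 : (X ^ 3 * (X + C 24) : ℚ[X]).natDegree = 4 := by compute_degree!
  have h40 : (X ^ 3 * (X + C 24) : ℚ[X]) ≠ 0 := by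
    intro h0
    simp [h0] at h4
  have hn0 : f.num ≠ 0 := by
    intro h0
    rw [h0, zero_mul] at h
    exact mul_ne_zero h40 hd0 h.symm
  have hdeg := congrArg natDegree h
  rw [natDegree_mul hn0 (X_sub_C_ne_zero 3), natDegree_mul h40 hd0, h4, natDegree_X_sub_C] at hdeg
  rw [natDegree_X_sub_C] at hd1
  lia

/-- Clearing denominators in a quadratic polynomial evaluated at a rational function. -/
lemma eval₂_mul_denom_sq {K : Type*} [Field K] {p : K[X]} (hp : p.natDegree ≤ 2) (h : RatFunc K) :
    eval₂ RatFunc.C h p * algebraMap K[X] (RatFunc K) h.denom ^ 2 =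
      algebraMap K[X] (RatFunc K) (C (p.coeff 2) * h.num ^ 2 + C (p.coeff 1) * h.num * h.denom +
        C (p.coeff 0) * h.denom ^ 2) := by
  have hd : algebraMap K[X] (RatFunc K) h.denom ≠ 0 :=
    RatFunc.algebraMap_ne_zero h.denom_ne_zero
  have hh : h * algebraMap K[X] (RatFunc K) h.denom = algebraMap K[X] (RatFunc K) h.num := by
    exact (div_eq_iff hd).1 (RatFunc.num_div_denom h) |>.symm
  rw [eval₂_eq_sum_range' _ (Nat.lt_succ_of_le hp)]
  simp only [Finset.sum_range_succ, Finset.sum_range_zero, map_add, map_mul,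
    map_pow, ← hh, RatFunc.algebraMap_C]
  ring

/-- The binary quadratic forms attached to the numerator and denominator of a rational function of
degree two have no common nontrivial zero. -/
lemma quadratic_forms_no_common_zero {K : Type*} [Field K] (g : RatFunc K)
    (hg : max g.num.natDegree g.denom.natDegree = 2) {a b : K} (hab : a ≠ 0 ∨ b ≠ 0)
    (hP : g.num.coeff 2 * a ^ 2 + g.num.coeff 1 * a * b + g.num.coeff 0 * b ^ 2 = 0)
    (hQ : g.denom.coeff 2 * a ^ 2 + g.denom.coeff 1 * a * b + g.denom.coeff 0 * b ^ 2 = 0) :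
    False := by
  by_cases hb : b = 0
  · have ha : a ≠ 0 := by simpa [hb] using hab
    have hp : g.num.coeff 2 = 0 := by simpa [hb, ha] using hP
    have hq : g.denom.coeff 2 = 0 := by simpa [hb, ha] using hQ
    rcases max_choice g.num.natDegree g.denom.natDegree with h | h <;> rw [hg] at h
    · rw [h, coeff_natDegree, leadingCoeff_eq_zero] at hp
      simp [hp] at h
    · rw [h, coeff_natDegree, leadingCoeff_eq_zero] at hq
      exact g.denom_ne_zero hq
  · have heval {p : K[X]} (hp : p.natDegree ≤ 2)
        (h : p.coeff 2 * a ^ 2 + p.coeff 1 * a * b + p.coeff 0 * b ^ 2 = 0) :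
        p.eval (a / b) = 0 := by
      rw [eval_eq_sum_range' (Nat.lt_succ_of_le hp)]
      simp only [Finset.sum_range_succ, Finset.sum_range_zero]
      field_simp
      linear_combination h
    obtain ⟨u, v, huv⟩ := RatFunc.isCoprime_num_denom g
    have := congrArg (eval (a / b)) huv
    simp [heval (hg ▸ le_max_left _ _) hP, heval (hg ▸ le_max_right _ _) hQ] at this

lemma degree_four_ne_rcomp_of_rdeg_two {g h : RatFunc ℚ} (hg : rdeg g = 2) (hh : rdeg h = 2) :
    RatFunc.X ^ 3 * (RatFunc.X + RatFunc.C (24 : ℚ)) / (RatFunc.X - RatFunc.C (3 : ℚ)) ≠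
      rcomp g h := by
  intro hf
  set A := h.num with hA
  set B := h.denom with hB
  set P := C (g.num.coeff 2) * A ^ 2 + C (g.num.coeff 1) * A * B + C (g.num.coeff 0) * B ^ 2
    with hP
  set Q := C (g.denom.coeff 2) * A ^ 2 + C (g.denom.coeff 1) * A * B + C (g.denom.coeff 0) * B ^ 2
    with hQ
  have hAB : IsCoprime A B := RatFunc.isCoprime_num_denom h
  have hPh := eval₂_mul_denom_sq (hg ▸ le_max_left _ _ : g.num.natDegree ≤ 2) h
  have hQh := eval₂_mul_denom_sq (hg ▸ le_max_right _ _ : g.denom.natDegree ≤ 2) h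
  have hzero : ¬ (P.eval 0 = 0 ∧ Q.eval 0 = 0) := by
    rintro ⟨h1, h2⟩
    refine quadratic_forms_no_common_zero g hg (a := A.eval 0) (b := B.eval 0) ?_
      (by simpa [hP] using h1) (by simpa [hQ] using h2)
    by_contra! hab
    obtain ⟨u, v, huv⟩ := hAB
    simpa [hab] using congrArg (eval 0) huv
  have hXne : (RatFunc.X - RatFunc.C 3 : RatFunc ℚ) ≠ 0 := by
    simpa using RatFunc.algebraMap_ne_zero (X_sub_C_ne_zero (3 : ℚ))
  have hQne : eval₂ RatFunc.C h g.denom ≠ 0 := by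
    intro h0
    rw [rcomp_eq_eval₂, h0, div_zero, div_eq_zero_iff, or_iff_left hXne] at hf
    have : (X ^ 3 * (X + C 24) : ℚ[X]) = 0 := RatFunc.algebraMap_injective ℚ (by simpa using hf)
    have := congrArg (eval 1) this
    norm_num at this
  have hcross : X ^ 3 * (X + C 24) * Q = P * (X - C 3) := by
    apply RatFunc.algebraMap_injective ℚ
    rw [rcomp_eq_eval₂, div_eq_div_iff hXne hQne] at hf
    rw [map_mul, map_mul _ P, ← hPh, ← hQh]
    simp only [map_mul, map_pow, map_add, map_sub, RatFunc.algebraMap_X, RatFunc.algebraMap_C]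
    linear_combination (algebraMap ℚ[X] (RatFunc ℚ) h.denom) ^ 2 * hf
  have hP0 : P.eval 0 = 0 := by simpa using (congrArg (eval 0) hcross).symm
  have hQ0 : Q.eval 0 ≠ 0 := fun h0 => hzero ⟨hP0, h0⟩
  have hcop : IsCoprime (X ^ 3 : ℚ[X]) (X - C 3) := by
    refine IsCoprime.pow_left ((irreducible_X.coprime_iff_not_dvd).2 ?_)
    simp [X_dvd_iff]
  obtain ⟨U, hU⟩ : X ^ 3 ∣ P :=
    hcop.dvd_of_dvd_mul_right ⟨(X + C 24) * Q, by rw [← hcross, mul_assoc]⟩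
  have hUQ : (X + C 24) * Q = U * (X - C 3) :=
    mul_left_cancel₀ (pow_ne_zero 3 X_ne_zero) (by rw [hU] at hcross; linear_combination hcross)
  have hU0 : U.eval 0 ≠ 0 := by
    intro h0
    have := congrArg (eval 0) hUQ
    simp [h0] at this
    exact hQ0 this
  exact X_pow_three_mul_ne_quadratic (hh ▸ le_max_left _ _ : A.natDegree ≤ 2)
    (hh ▸ le_max_right _ _ : B.natDegree ≤ 2) hAB hU0 _ _ _ hU.symm

/-- The rational function `g = t³(t + 24)/(t − 3)` has degree 4 and is
indecomposable. -/
theorem indecomposable_degree_four :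
    rdeg (RatFunc.X ^ 3 * (RatFunc.X + RatFunc.C (24 : ℚ)) /
        (RatFunc.X - RatFunc.C (3 : ℚ))) = 4 ∧
    Indecomposable (RatFunc.X ^ 3 * (RatFunc.X + RatFunc.C (24 : ℚ)) /
        (RatFunc.X - RatFunc.C (3 : ℚ))) := by
  have hdeg := rdeg_degree_four
  refine ⟨hdeg, fun c hc => ?_, fun hu => ?_, fun g h _ hh hf => ?_⟩
  · rw [hc] at hdeg
    rw [rdeg, RatFunc.num_C, RatFunc.denom_C, natDegree_C, natDegree_one] at hdeg
    lia
  · rw [IsCompUnit, hdeg] at hu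
    lia
  · have hmul : rdeg g * rdeg h = 4 := by rw [← rdeg_rcomp g h hh, ← hf, hdeg]
    have hle : rdeg g ≤ 4 := Nat.le_of_dvd (by lia) ⟨_, hmul.symm⟩
    unfold IsCompUnit
    by_contra! hne
    have hg : rdeg g = 2 := by
      interval_cases rdeg g <;> lia
    exact degree_four_ne_rcomp_of_rdeg_two hg (by rw [hg] at hmul; lia) hf
end
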